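/- Let f : ℝ² → ℝ be a polynomial of degree d ≥ 1 with rational coefficients. If f is homogeneous translatable, i.e., there exists t ∈ ℝ² such that x ↦ f(x + t) is a homogeneous polynomial, then there exists a rational translation vector t ∈ ℚ² such that x ↦ f(x + t) is a homogeneous polynomial. -/

import Mathlib

open MvPolynomial in
/-- translation by `t` -/
noncomputable def shiftHom (t : Fin 2 → ℝ) :
    MvPolynomial (Fin 2) ℝ →ₐ[ℝ] MvPolynomial (Fin 2) ℝ :=
  aeval (fun i => X i + C (t i))

open MvPolynomial in
lemma eval_shiftHom (t x : Fin 2 → ℝ) (f : MvPolynomial (Fin 2) ℝ) :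
    eval x (shiftHom t f) = eval (x + t) f := by
  induction f using MvPolynomial.induction_on with
  | C a => simp [shiftHom]
  | add p q hp hq => simp [hp, hq]
  | mul_X p i hp => simp [hp]; simp [shiftHom]

open MvPolynomial in
lemma pderiv_shiftHom (t : Fin 2 → ℝ) (i : Fin 2) (f : MvPolynomial (Fin 2) ℝ) :
    pderiv i (shiftHom t f) = shiftHom t (pderiv i f) := by
  induction f using MvPolynomial.induction_on with
  | C a => simp [shiftHom]
  | add p q hp hq => simp [hp, hq]
  | mul_X p j hp =>
    have h1 : shiftHom t (X j) = X j + C (t j) := by simp [shiftHom]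
    by_cases h : j = i
    · subst h
      simp [Derivation.leibniz, hp, h1]
    · simp [Derivation.leibniz, hp, h1, pderiv_X_of_ne h]

lemma shiftHom_inj (t : Fin 2 → ℝ) (p q : MvPolynomial (Fin 2) ℝ)
    (h : shiftHom t p = shiftHom t q) : p = q := by
  apply MvPolynomial.funext
  intro x
  have := congrArg (MvPolynomial.eval (x - t)) h
  simpa [eval_shiftHom] using this

open MvPolynomial in
lemma coeff_X_mul_pderiv (i : Fin 2) (m : Fin 2 →₀ ℕ) (f : MvPolynomial (Fin 2) ℝ) :
    coeff m (X i * pderiv i f) = m i * coeff m f := by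
  induction f using MvPolynomial.induction_on' with
  | monomial u a =>
    rw [X_mul_pderiv_monomial]
    simp only [coeff_smul, coeff_monomial]
    split_ifs with h
    · subst h; simp
    · simp
  | add p q hp hq => simp [mul_add, hp, hq]

open MvPolynomial in
lemma homog_of_euler (e : ℕ) (g : MvPolynomial (Fin 2) ℝ)
    (h : ∑ i, X i * pderiv i g = e • g) : g.IsHomogeneous e := by
  intro m hm
  have := congrArg (coeff m) h
  simp only [Fin.sum_univ_two, coeff_add, coeff_X_mul_pderiv, coeff_smul] at this
  rw [← add_mul, nsmul_eq_mul] at this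
  have h2 := mul_right_cancel₀ hm this
  rw [Finsupp.weight_apply, Finsupp.sum_fintype _ _ (by simp)]
  simp
  exact_mod_cast h2

open MvPolynomial in
lemma euler_shift (t : Fin 2 → ℝ) (e : ℕ) (f : MvPolynomial (Fin 2) ℝ) :
    (shiftHom t f).IsHomogeneous e ↔
      ∑ i, C (t i) * pderiv i f = ∑ i, X i * pderiv i f - e • f := by
  have key : shiftHom t (∑ i, C (t i) * pderiv i f) =
      ∑ i, C (t i) * pderiv i (shiftHom t f) := by
    simp only [map_sum, map_mul, pderiv_shiftHom]
    simp [shiftHom]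
  have key2 : shiftHom t (∑ i, X i * pderiv i f - e • f) =
      ∑ i, (X i + C (t i)) * pderiv i (shiftHom t f) - e • shiftHom t f := by
    simp only [map_sub, map_nsmul, map_sum, map_mul, pderiv_shiftHom]
    simp [shiftHom]
  constructor
  · intro h
    apply shiftHom_inj t
    rw [key, key2, ← h.sum_X_mul_pderiv]
    simp only [Fin.sum_univ_two]
    ring
  · intro h
    apply homog_of_euler
    have := congrArg (shiftHom t) h
    rw [key, key2] at this
    simp only [Fin.sum_univ_two] at this ⊢
    linear_combination -this

open MvPolynomial in
theorem stmt_19 (f : MvPolynomial (Fin 2) ℝ) (d : ℕ) (hd : 1 ≤ d)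
    (hdeg : f.totalDegree = d)
    (hrat : ∀ m : Fin 2 →₀ ℕ, ∃ q : ℚ, f.coeff m = (q : ℝ))
    (hht : ∃ (t : Fin 2 → ℝ) (h : MvPolynomial (Fin 2) ℝ) (e : ℕ),
      h.IsHomogeneous e ∧
        ∀ x : Fin 2 → ℝ, MvPolynomial.eval (x + t) f = MvPolynomial.eval x h) :
    ∃ (t : Fin 2 → ℚ) (h : MvPolynomial (Fin 2) ℝ) (e : ℕ),
      h.IsHomogeneous e ∧
        ∀ x : Fin 2 → ℝ,
          MvPolynomial.eval (x + fun i => ((t i : ℝ))) f = MvPolynomial.eval x h := by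
  obtain ⟨t, h, e, hh, hx⟩ := hht
  have hs : shiftHom t f = h := by
    apply MvPolynomial.funext
    intro x
    rw [eval_shiftHom, hx]
  rw [← hs, euler_shift] at hh
  have hF : f ∈ Set.range (map (σ := Fin 2) (algebraMap ℚ ℝ)) := by
    choose q hq using hrat
    refine ⟨∑ m ∈ f.support, monomial m (q m), ?_⟩
    conv_rhs => rw [f.as_sum]
    simp [map_sum, hq]
  obtain ⟨F, rfl⟩ := hF
  obtain ⟨φ, hφ⟩ := LinearMap.exists_leftInverse_of_injective (Algebra.linearMap ℚ ℝ)
    (LinearMap.ker_eq_bot.2 (algebraMap ℚ ℝ).injective)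
  have hφ1 : ∀ q : ℚ, φ (algebraMap ℚ ℝ q) = q := fun q => LinearMap.congr_fun hφ q
  have hφ2 : ∀ (r : ℝ) (q : ℚ), φ (r * algebraMap ℚ ℝ q) = φ r * q := by
    intro r q
    rw [mul_comm, ← Algebra.smul_def, map_smul, smul_eq_mul, mul_comm]
  refine ⟨fun i => φ (t i), _, e, (euler_shift (fun i => ((φ (t i) : ℚ) : ℝ)) e _).2 ?_,
    fun x => (eval_shiftHom _ x _).symm⟩
  have hR : ∑ i, X i * pderiv i (map (algebraMap ℚ ℝ) F) - e • map (algebraMap ℚ ℝ) F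
      = map (algebraMap ℚ ℝ) (∑ i, X i * pderiv i F - e • F) := by
    simp [pderiv_map]
  rw [hR] at hh ⊢
  ext m
  have hm := congrArg φ (congrArg (coeff m) hh)
  simp only [Fin.sum_univ_two, coeff_add, coeff_C_mul, pderiv_map, coeff_map, map_add,
    hφ2, hφ1] at hm ⊢
  rw [← hm]
  simp
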